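/- arXiv:2203.06623 — 3 statements merged into one kernel-verified Lean document; each statement's English description precedes it below -/
import Mathlib

section
/- Let α > 0 with α ≠ 1, and let u be a radial function such that Σ_{k=−∞}^{m} max(p^k, p^{αk}) |u(p^k)| < ∞ for some m ∈ ℤ. Then for every x ≠ 0 the integral defining (I^α u)(x) converges absolutely, (I^α u)(x) depends only on |x|_p, and (I^α u)(|x|_p) = p^{−α} |x|_p^{α} u(|x|_p) + ((1 − p^{−α})/(1 − p^{α−1})) ∫_{|y|_p < |x|_p} (|x|_p^{α−1} − |y|_p^{α−1}) u(|y|_p) dy. -/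
open MeasureTheory Metric

noncomputable section

variable (p : ℕ) [Fact p.Prime]

instance : MeasurableSpace ℚ_[p] := borel _
instance : BorelSpace ℚ_[p] := ⟨rfl⟩

/-- The closed unit ball of `ℚ_[p]` as a positive compact set. -/
def unitBallPC : TopologicalSpace.PositiveCompacts ℚ_[p] where
  carrier := closedBall 0 1
  isCompact' := isCompact_closedBall 0 1
  interior_nonempty' := ⟨0, mem_interior_iff_mem_nhds.2
    (Filter.mem_of_superset (ball_mem_nhds 0 one_pos) ball_subset_closedBall)⟩

/-- The Haar measure on `ℚ_[p]` normalized so the unit ball has measure 1. -/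
def padicHaar : Measure ℚ_[p] := Measure.addHaarMeasure (unitBallPC p)

/-- A point on the sphere of radius `p^k`. -/
def sph (k : ℤ) : ℚ_[p] := (p : ℚ_[p]) ^ (-k)

/-- A function is radial if it depends only on the p-adic absolute value. -/
def Radial (u : ℚ_[p] → ℝ) : Prop := ∀ x y : ℚ_[p], ‖x‖ = ‖y‖ → u x = u y

/-- The integrand of the Vladimirov operator `D^α` at `x`. -/
def Dker (α : ℝ) (u : ℚ_[p] → ℝ) (x : ℚ_[p]) : ℚ_[p] → ℝ :=
  fun y => ‖y‖ ^ (-α - 1) * (u (x - y) - u x)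

/-- The Vladimirov fractional differentiation operator. -/
def Dop (α : ℝ) (u : ℚ_[p] → ℝ) (x : ℚ_[p]) : ℝ :=
  ((1 - (p : ℝ) ^ α) / (1 - (p : ℝ) ^ (-α - 1))) * ∫ y, Dker p α u x y ∂(padicHaar p)

/-- The kernel of the fractional integral `I^α`. -/
def Iker (α : ℝ) (x y : ℚ_[p]) : ℝ :=
  if α = 1 then Real.log ‖x - y‖ - Real.log ‖y‖
  else ‖x - y‖ ^ (α - 1) - ‖y‖ ^ (α - 1)

/-- The constant in front of the fractional integral. -/
def Icoef (α : ℝ) : ℝ :=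
  if α = 1 then (1 - (p : ℝ)) / (p * Real.log p)
  else (1 - (p : ℝ) ^ (-α)) / (1 - (p : ℝ) ^ (α - 1))

/-- The p-adic fractional integral `I^α`. -/
def Iop (α : ℝ) (u : ℚ_[p] → ℝ) (x : ℚ_[p]) : ℝ :=
  Icoef p α * ∫ y in {y : ℚ_[p] | ‖y‖ ≤ ‖x‖}, Iker p α x y * u y ∂(padicHaar p)

end

instance padicHaar_isAddHaar (p : ℕ) [Fact p.Prime] : (padicHaar p).IsAddHaarMeasure := by
  unfold padicHaar; infer_instance

lemma padicHaar_ne_top (p : ℕ) [Fact p.Prime] (z : ℚ_[p]) (r : ℝ) :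
    padicHaar p (closedBall z r) ≠ ⊤ :=
  (isCompact_closedBall z r).measure_lt_top.ne

lemma ball_step (p : ℕ) [Fact p.Prime] (k : ℤ) :
    (padicHaar p).real (closedBall 0 ((p : ℝ) ^ (k + 1))) =
      p * (padicHaar p).real (closedBall 0 ((p : ℝ) ^ k)) := by
  have hp : (0 : ℝ) < p := by exact_mod_cast (Fact.out : p.Prime).pos
  have hp0 : (p : ℚ_[p]) ≠ 0 := by exact_mod_cast (Fact.out : p.Prime).ne_zero
  have hU : closedBall (0 : ℚ_[p]) ((p : ℝ) ^ (k + 1)) =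
      ⋃ i ∈ Finset.range p, closedBall ((i : ℚ_[p]) * (p : ℚ_[p]) ^ (-(k + 1))) ((p : ℝ) ^ k) := by
    ext y
    simp only [mem_closedBall, dist_eq_norm, sub_zero, Set.mem_iUnion, Finset.mem_range,
      exists_prop]
    constructor
    · intro hy
      have hz : ‖y * (p : ℚ_[p]) ^ (k + 1)‖ ≤ 1 := by
        rw [norm_mul, Padic.norm_p_zpow, zpow_neg]
        exact mul_inv_le_one_of_le₀ hy (by positivity)
      obtain ⟨i, hi, hm⟩ := PadicInt.exists_mem_range (p := p) (x := ⟨_, hz⟩)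
      refine ⟨i, hi, ?_⟩
      rw [IsLocalRing.mem_maximalIdeal, PadicInt.mem_nonunits, PadicInt.norm_def] at hm
      rw [Padic.norm_le_pow_iff_norm_lt_pow_add_one]
      have : y - (i : ℚ_[p]) * (p : ℚ_[p]) ^ (-(k + 1)) =
          (y * (p : ℚ_[p]) ^ (k + 1) - i) * (p : ℚ_[p]) ^ (-(k + 1)) := by
        rw [sub_mul, mul_assoc, ← zpow_add₀ hp0]; simp
      rw [this, norm_mul, Padic.norm_p_zpow, neg_neg]
      exact mul_lt_of_lt_one_left (by positivity) hm
    · rintro ⟨i, hi, h⟩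
      have h2 : ‖(i : ℚ_[p]) * (p : ℚ_[p]) ^ (-(k + 1))‖ ≤ (p : ℝ) ^ (k + 1) := by
        rw [norm_mul, Padic.norm_p_zpow, neg_neg]
        exact mul_le_of_le_one_left (by positivity)
          (by simpa using Padic.norm_int_le_one (p := p) i)
      have h3 := Padic.nonarchimedean (y - (i : ℚ_[p]) * (p : ℚ_[p]) ^ (-(k + 1)))
        ((i : ℚ_[p]) * (p : ℚ_[p]) ^ (-(k + 1)))
      rw [sub_add_cancel] at h3
      refine h3.trans (max_le (h.trans ?_) h2)
      exact zpow_le_zpow_right₀ (by exact_mod_cast (Fact.out : p.Prime).one_lt.le) (by lia)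
  rw [hU, measureReal_biUnion_finset ?_ ?_ (fun i _ => padicHaar_ne_top p _ _)]
  · have : ∀ i ∈ Finset.range p, (padicHaar p).real
        (closedBall ((i : ℚ_[p]) * (p : ℚ_[p]) ^ (-(k + 1))) ((p : ℝ) ^ k)) =
        (padicHaar p).real (closedBall 0 ((p : ℝ) ^ k)) := by
      intro i _
      simp only [Measure.real]
      rw [Measure.addHaar_closedBall_center]
    rw [Finset.sum_congr rfl this]
    simp
  · intro i hi j hj hij
    simp only [Finset.coe_range, Set.mem_Iio] at hi hj
    rw [Function.onFun, Set.disjoint_left]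
    intro y hy1 hy2
    apply hij
    rw [mem_closedBall', dist_eq_norm] at hy1
    rw [mem_closedBall, dist_eq_norm] at hy2
    have h3 := Padic.nonarchimedean _ _ |>.trans (max_le hy1 hy2)
    rw [sub_add_sub_cancel, ← sub_mul, norm_mul, Padic.norm_p_zpow, neg_neg,
      zpow_add_one₀ hp.ne'] at h3
    have h4 : ‖(((i : ℤ) - j : ℤ) : ℚ_[p])‖ < 1 := by
      push_cast
      by_contra! h
      have hk : (0 : ℝ) < (p : ℝ) ^ k := by positivity
      have h1p : (1 : ℝ) < p := by exact_mod_cast (Fact.out : p.Prime).one_lt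
      have := mul_le_mul_of_nonneg_right h (by positivity : (0 : ℝ) ≤ (p : ℝ) ^ k * p)
      nlinarith
    rw [Padic.norm_intCast_lt_one_iff] at h4
    have := Int.eq_zero_of_abs_lt_dvd h4 (by rw [abs_lt]; constructor <;> lia)
    lia
  · intro i _
    exact isClosed_closedBall.measurableSet
lemma ball_meas (p : ℕ) [Fact p.Prime] (k : ℤ) :
    (padicHaar p).real (closedBall 0 ((p : ℝ) ^ k)) = (p : ℝ) ^ k := by
  have hp : (p : ℝ) ≠ 0 := by exact_mod_cast (Fact.out : p.Prime).ne_zero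
  induction k using Int.induction_on with
  | zero =>
    have : padicHaar p (closedBall 0 1) = 1 := Measure.addHaarMeasure_self (K₀ := unitBallPC p)
    simp [Measure.real, this]
  | succ i ih => rw [ball_step, ih, zpow_add_one₀ hp]; ring
  | pred i ih =>
    have := ball_step p (-(i : ℤ) - 1)
    rw [sub_add_cancel, ih] at this
    have e := zpow_sub_one₀ hp (-(i : ℤ))
    rw [this] at e
    rw [mul_comm, ← mul_assoc, inv_mul_cancel₀ hp, one_mul] at e
    exact e.symm

lemma sphere_meas (p : ℕ) [Fact p.Prime] (k : ℤ) :
    (padicHaar p).real (sphere 0 ((p : ℝ) ^ k)) = (1 - (p : ℝ)⁻¹) * (p : ℝ) ^ k := by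
  have hp : (p : ℝ) ≠ 0 := by exact_mod_cast (Fact.out : p.Prime).ne_zero
  have h1 : (1 : ℝ) ≤ p := by exact_mod_cast (Fact.out : p.Prime).one_lt.le
  have : sphere (0 : ℚ_[p]) ((p : ℝ) ^ k) =
      closedBall 0 ((p : ℝ) ^ k) \ closedBall 0 ((p : ℝ) ^ (k - 1)) := by
    ext y
    simp only [mem_sphere, mem_closedBall, dist_zero_right, Set.mem_sdiff]
    rw [Padic.norm_le_pow_iff_norm_lt_pow_add_one y (k - 1), sub_add_cancel, not_lt]
    exact ⟨fun h => ⟨h.le, h.ge⟩, fun h => le_antisymm h.1 h.2⟩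
  rw [this, measureReal_sdiff (closedBall_subset_closedBall
    (zpow_le_zpow_right₀ h1 (by lia))) isClosed_closedBall.measurableSet (padicHaar_ne_top p _ _),
    ball_meas, ball_meas, zpow_sub_one₀ hp]
  ring

lemma norm_sph (p : ℕ) [Fact p.Prime] (k : ℤ) : ‖sph p k‖ = (p : ℝ) ^ k := by
  rw [sph, Padic.norm_p_zpow, neg_neg]

lemma radial_int (p : ℕ) [Fact p.Prime] (f : ℚ_[p] → ℝ) (hf : Radial p f) (n : ℤ)
    (hs : Summable fun j : ℕ => (p : ℝ) ^ (n - j : ℤ) * |f (sph p (n - j))|) :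
    IntegrableOn f (closedBall 0 ((p : ℝ) ^ n)) (padicHaar p) ∧
    HasSum (fun j : ℕ => (1 - (p : ℝ)⁻¹) * (p : ℝ) ^ (n - j : ℤ) * f (sph p (n - j)))
      (∫ y in closedBall 0 ((p : ℝ) ^ n), f y ∂(padicHaar p)) := by
  have h1 : (1 : ℝ) < p := by exact_mod_cast (Fact.out : p.Prime).one_lt
  have hp : (0 : ℝ) < p := by linarith
  let S : ℕ → Set ℚ_[p] := fun j => sphere 0 ((p : ℝ) ^ (n - j : ℤ))
  have hm : ∀ j, MeasurableSet (S j) := fun j => isClosed_sphere.measurableSet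
  have hfin : ∀ j, padicHaar p (S j) ≠ ⊤ := fun j => (isCompact_sphere _ _).measure_lt_top.ne
  have hval : ∀ j, ∀ y ∈ S j, f y = f (sph p (n - j)) := by
    intro j y hy
    apply hf
    rw [norm_sph]
    simpa [S] using hy
  have hd : Pairwise (Function.onFun Disjoint S) := by
    intro i j hij
    rw [Function.onFun, Set.disjoint_left]
    intro y hy1 hy2
    simp only [S, mem_sphere, dist_zero_right] at hy1 hy2
    rw [hy1] at hy2
    have := zpow_right_injective₀ hp h1.ne' hy2
    apply hij; lia
  have hU : closedBall 0 ((p : ℝ) ^ n) =ᵐ[padicHaar p] ⋃ j, S j := by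
    have : closedBall 0 ((p : ℝ) ^ n) = insert 0 (⋃ j, S j) := by
      ext y
      simp only [S, mem_closedBall, mem_sphere, dist_zero_right, Set.mem_insert_iff,
        Set.mem_iUnion]
      constructor
      · intro hy
        by_cases h0 : y = 0
        · exact Or.inl h0
        right
        rw [Padic.norm_eq_zpow_neg_valuation h0] at hy ⊢
        have := (zpow_le_zpow_iff_right₀ h1).1 hy
        refine ⟨(n + y.valuation).toNat, ?_⟩
        congr 1; lia
      · rintro (h | ⟨j, h⟩)
        · rw [h, norm_zero]; positivity
        · rw [h]; exact zpow_le_zpow_right₀ h1.le (by lia)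
    rw [this]
    exact insert_ae_eq_self _ _
  have hi : ∀ j, IntegrableOn f (S j) (padicHaar p) := fun j =>
    (integrableOn_congr_fun (hval j) (hm j)).2 (integrableOn_const (hfin j))
  have hI : IntegrableOn f (⋃ j, S j) (padicHaar p) := by
    refine integrableOn_iUnion_of_summable_integral_norm hi ?_
    refine (hs.mul_left (1 - (p : ℝ)⁻¹)).congr fun j => ?_
    rw [setIntegral_congr_fun (g := fun _ => |f (sph p (n - j))|) (hm j)
      (fun y hy => by simp [hval j y hy])]
    rw [setIntegral_const, sphere_meas]
    simp [mul_assoc]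
  refine ⟨hI.congr_set_ae hU, ?_⟩
  rw [setIntegral_congr_set hU]
  have hH := hasSum_integral_iUnion hm hd hI
  have he : (fun j : ℕ => ∫ y in S j, f y ∂(padicHaar p)) =
      fun j : ℕ => (1 - (p : ℝ)⁻¹) * (p : ℝ) ^ (n - j : ℤ) * f (sph p (n - j)) := by
    ext j
    rw [setIntegral_congr_fun (hm j) (hval j), setIntegral_const, sphere_meas, smul_eq_mul]
  rwa [he] at hH

lemma summable_shift (g : ℤ → ℝ) (m n : ℤ) (h : Summable fun j : ℕ => g (m - j)) :
    Summable fun j : ℕ => g (n - j) := by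
  rcases le_total n m with hnm | hnm
  · refine ((summable_nat_add_iff (m - n).toNat).2 h).congr fun j => ?_
    congr 1; push_cast; lia
  · rw [← summable_nat_add_iff (n - m).toNat]
    refine h.congr fun j => ?_
    congr 1; push_cast; lia

lemma pow_int (p : ℕ) [Fact p.Prime] (α : ℝ) (hα : 0 < α) (n : ℤ) :
    IntegrableOn (fun y : ℚ_[p] => ‖y‖ ^ (α - 1)) (closedBall 0 ((p : ℝ) ^ n)) (padicHaar p) ∧
    ∫ y in closedBall (0 : ℚ_[p]) ((p : ℝ) ^ n), ‖y‖ ^ (α - 1) ∂(padicHaar p) =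
      (1 - (p : ℝ)⁻¹) * ((p : ℝ) ^ n) ^ α * (1 - (p : ℝ) ^ (-α))⁻¹ := by
  have h1 : (1 : ℝ) < p := by exact_mod_cast (Fact.out : p.Prime).one_lt
  have hp : (0 : ℝ) < p := by linarith
  have key : ∀ j : ℕ, (p : ℝ) ^ (n - j : ℤ) * ‖sph p (n - j)‖ ^ (α - 1) =
      ((p : ℝ) ^ n) ^ α * ((p : ℝ) ^ (-α)) ^ j := by
    intro j
    rw [norm_sph, ← Real.rpow_intCast, ← Real.rpow_intCast, ← Real.rpow_natCast,
      ← Real.rpow_mul hp.le, ← Real.rpow_mul hp.le, ← Real.rpow_mul hp.le, ← Real.rpow_add hp,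
      ← Real.rpow_add hp]
    congr 1; push_cast; ring
  have hr0 : 0 ≤ (p : ℝ) ^ (-α) := by positivity
  have hr1 : (p : ℝ) ^ (-α) < 1 := Real.rpow_lt_one_of_one_lt_of_neg h1 (by linarith)
  have hg := (hasSum_geometric_of_lt_one hr0 hr1).mul_left (((p : ℝ) ^ n) ^ α)
  obtain ⟨ha, hb⟩ := radial_int p (fun y => ‖y‖ ^ (α - 1)) (fun x y h => by simp only [h]) n (by
    refine hg.summable.congr fun j => ?_
    rw [← key, abs_of_nonneg (by positivity)])
  refine ⟨ha, ?_⟩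
  refine hb.unique ?_
  have := hg.mul_left (1 - (p : ℝ)⁻¹)
  simp_rw [← key, ← mul_assoc] at this
  exact this

lemma main_aux (p : ℕ) [Fact p.Prime] (α : ℝ) (hα : 0 < α) (hα1 : α ≠ 1)
    (u : ℚ_[p] → ℝ) (hu : Radial p u) (m : ℤ)
    (h1 : Summable fun j : ℕ =>
      max ((p : ℝ) ^ (m - j : ℤ)) ((p : ℝ) ^ (α * ((m - j : ℤ) : ℝ))) * |u (sph p (m - j))|)
    (x : ℚ_[p]) (hx : x ≠ 0) :
    IntegrableOn (fun y => Iker p α x y * u y) {y : ℚ_[p] | ‖y‖ ≤ ‖x‖} (padicHaar p) ∧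
    Iop p α u x =
      (p : ℝ) ^ (-α) * ‖x‖ ^ α * u x +
        ((1 - (p : ℝ) ^ (-α)) / (1 - (p : ℝ) ^ (α - 1))) *
          ∫ y in {y : ℚ_[p] | ‖y‖ < ‖x‖}, (‖x‖ ^ (α - 1) - ‖y‖ ^ (α - 1)) * u y ∂(padicHaar p) := by
  have hp1 : (1 : ℝ) < p := by exact_mod_cast (Fact.out : p.Prime).one_lt
  have hp : (0 : ℝ) < p := by linarith
  obtain ⟨n, hn⟩ : ∃ n : ℤ, ‖x‖ = (p : ℝ) ^ n := ⟨_, Padic.norm_eq_zpow_neg_valuation hx⟩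
  have hK : {y : ℚ_[p] | ‖y‖ ≤ ‖x‖} = closedBall 0 ((p : ℝ) ^ n) := by
    ext y; simp [hn]
  set K := closedBall (0 : ℚ_[p]) ((p : ℝ) ^ n) with hKdef
  have hKm : MeasurableSet K := isClosed_closedBall.measurableSet
  have hKt : padicHaar p K ≠ ⊤ := padicHaar_ne_top p _ _
  have hsum := summable_shift (fun k : ℤ =>
    max ((p : ℝ) ^ k) ((p : ℝ) ^ (α * (k : ℝ))) * |u (sph p k)|) m n h1
  set f : ℚ_[p] → ℝ := fun y => (‖x‖ ^ (α - 1) - ‖y‖ ^ (α - 1)) * u y with hf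
  have hfI : IntegrableOn f K (padicHaar p) := by
    refine (radial_int p f (fun y z h => by simp only [hf, h, hu y z h]) n ?_).1
    refine Summable.of_nonneg_of_le (fun j => by positivity) (fun j => ?_)
      (hsum.mul_left (‖x‖ ^ (α - 1) + 1))
    generalize (n - j : ℤ) = k
    simp only [hf, norm_sph, abs_mul]
    have e : (p : ℝ) ^ (α * (k : ℝ)) = (p : ℝ) ^ k * ((p : ℝ) ^ k) ^ (α - 1) := by
      rw [← Real.rpow_intCast, ← Real.rpow_mul hp.le, ← Real.rpow_add hp]
      congr 1; ring
    rw [e, ← mul_assoc, ← mul_assoc]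
    refine mul_le_mul_of_nonneg_right ?_ (abs_nonneg _)
    have hA : 0 ≤ ‖x‖ ^ (α - 1) := by positivity
    have hB : 0 ≤ ((p : ℝ) ^ k) ^ (α - 1) := by positivity
    have hk : 0 < (p : ℝ) ^ k := by positivity
    have h3 : |‖x‖ ^ (α - 1) - ((p : ℝ) ^ k) ^ (α - 1)| ≤
        ‖x‖ ^ (α - 1) + ((p : ℝ) ^ k) ^ (α - 1) := by
      rw [abs_le]; constructor <;> linarith
    calc _ ≤ (p : ℝ) ^ k * (‖x‖ ^ (α - 1) + ((p : ℝ) ^ k) ^ (α - 1)) := by gcongr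
      _ = ‖x‖ ^ (α - 1) * (p : ℝ) ^ k + (p : ℝ) ^ k * ((p : ℝ) ^ k) ^ (α - 1) := by ring
      _ ≤ _ := by
        rw [add_mul, one_mul]
        gcongr
        · exact le_max_left _ _
        · exact le_max_right _ _
  -- translation
  obtain ⟨hgI, hgv⟩ := pow_int p α hα n
  rw [← hKdef] at hgI hgv
  have hxK : ∀ y, x - y ∈ K ↔ y ∈ K := by
    have hsub : ∀ y, y ∈ K → x - y ∈ K := by
      intro y hy
      simp only [hKdef, mem_closedBall, dist_zero_right] at hy ⊢
      have := Padic.nonarchimedean x (-y)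
      rw [norm_neg, ← sub_eq_add_neg] at this
      exact this.trans (max_le hn.le hy)
    intro y
    exact ⟨fun h => by simpa using hsub _ h, hsub y⟩
  have hind : K.indicator (fun y => ‖x - y‖ ^ (α - 1)) =
      fun y => K.indicator (fun y : ℚ_[p] => ‖y‖ ^ (α - 1)) (x - y) := by
    ext y
    by_cases hy : y ∈ K
    · rw [Set.indicator_of_mem hy, Set.indicator_of_mem ((hxK y).2 hy)]
    · rw [Set.indicator_of_notMem hy, Set.indicator_of_notMem (fun h => hy ((hxK y).1 h))]
  have htI : IntegrableOn (fun y => ‖x - y‖ ^ (α - 1)) K (padicHaar p) := by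
    rw [← integrable_indicator_iff hKm, hind]
    exact (hgI.integrable_indicator hKm).comp_sub_left x
  have htv : ∫ y in K, ‖x - y‖ ^ (α - 1) ∂(padicHaar p) =
      ∫ y in K, ‖y‖ ^ (α - 1) ∂(padicHaar p) := by
    rw [← integral_indicator hKm, hind, ← integral_indicator hKm]
    exact integral_sub_left_eq_self _ (padicHaar p) x
  have hdec : Set.EqOn (fun y => Iker p α x y * u y)
      (fun y => f y + (‖x - y‖ ^ (α - 1) - ‖x‖ ^ (α - 1)) * u x) K := by
    intro y hy
    have hy' : ‖y‖ ≤ ‖x‖ := by rw [← hK] at hy; exact hy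
    simp only [Iker, hα1, if_false, hf]
    rcases hy'.lt_or_eq with h | h
    · have : ‖x - y‖ = ‖x‖ := by
        have := Padic.add_eq_max_of_ne (q := x) (r := -y) (by rw [norm_neg]; exact h.ne')
        rw [norm_neg, ← sub_eq_add_neg, max_eq_left h.le] at this
        exact this
      rw [this]; ring
    · rw [h, hu y x h]; ring
  have hcI : IntegrableOn (fun y => (‖x - y‖ ^ (α - 1) - ‖x‖ ^ (α - 1)) * u x) K (padicHaar p) :=
    (htI.sub (integrableOn_const hKt)).mul_const _
  have hball : ∫ y in {y : ℚ_[p] | ‖y‖ < ‖x‖}, f y ∂(padicHaar p) =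
      ∫ y in K, f y ∂(padicHaar p) := by
    symm
    refine setIntegral_eq_of_subset_of_forall_sdiff_eq_zero hKm ?_ ?_
    · rw [← hK]; intro y hy; exact (show ‖y‖ < ‖x‖ from hy).le
    · rintro y ⟨hy1, hy2⟩
      rw [← hK] at hy1
      have : ‖y‖ = ‖x‖ := le_antisymm hy1 (not_lt.1 hy2)
      simp [hf, this]
  rw [hK, Iop, hK, hball]
  refine ⟨(integrableOn_congr_fun hdec hKm).2 (hfI.add hcI), ?_⟩
  rw [setIntegral_congr_fun hKm hdec, integral_add hfI hcI, integral_mul_const,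
    integral_sub htI (integrableOn_const hKt), htv, hgv, setIntegral_const, hKdef, ball_meas,
    Icoef, if_neg hα1, hn, mul_add, add_comm]
  congr 1
  have ha : (1 - (p : ℝ) ^ (-α)) ≠ 0 := by
    have := Real.rpow_lt_one_of_one_lt_of_neg hp1 (by linarith : -α < 0)
    linarith
  have hb : (1 - (p : ℝ) ^ (α - 1)) ≠ 0 := by
    intro h
    have h' : (p : ℝ) ^ (α - 1) = 1 := by linarith
    rcases lt_or_gt_of_ne hα1 with h2 | h2
    · exact (Real.rpow_lt_one_of_one_lt_of_neg hp1 (by linarith : α - 1 < 0)).ne h'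
    · exact (Real.one_lt_rpow hp1 (by linarith : 0 < α - 1)).ne' h'
  have e1 : ((p : ℝ) ^ n) ^ (α - 1) = ((p : ℝ) ^ n) ^ α / (p : ℝ) ^ n :=
    Real.rpow_sub_one (by positivity) _
  have e2 : (p : ℝ) ^ (α - 1) = (p : ℝ) ^ α / p := Real.rpow_sub_one hp.ne' _
  have e3 : (p : ℝ) ^ (-α) = ((p : ℝ) ^ α)⁻¹ := Real.rpow_neg hp.le _
  have hpa : (0 : ℝ) < (p : ℝ) ^ α := by positivity
  have hpn : (0 : ℝ) < (p : ℝ) ^ n := by positivity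
  rw [e3] at ha
  rw [e2] at hb
  rw [smul_eq_mul, e1, e2, e3]
  clear e1 e2 e3
  rw [div_mul_eq_mul_div, div_eq_iff hb]
  generalize ((p : ℝ) ^ n) ^ α = N at *
  generalize (p : ℝ) ^ α = A at *
  generalize (p : ℝ) ^ n = M at *
  have hc : (1 - A⁻¹) * (1 - A⁻¹)⁻¹ = 1 := mul_inv_cancel₀ ha
  have hM : M * (N / M) = N := by field_simp
  rw [hM]
  calc _ = ((1 - (p : ℝ)⁻¹) * N * ((1 - A⁻¹) * (1 - A⁻¹)⁻¹) - (1 - A⁻¹) * N) * u x := by ring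
    _ = _ := by
      rw [hc]; field_simp; ring

/-- the fractional integral of a radial function, `α ≠ 1`. -/
theorem fractional_integral_radial (p : ℕ) [Fact p.Prime] (α : ℝ) (hα : 0 < α) (hα1 : α ≠ 1)
    (u : ℚ_[p] → ℝ) (hu : Radial p u) (m : ℤ)
    (h1 : Summable fun j : ℕ =>
      max ((p : ℝ) ^ (m - j : ℤ)) ((p : ℝ) ^ (α * ((m - j : ℤ) : ℝ))) * |u (sph p (m - j))|)
    (x : ℚ_[p]) (hx : x ≠ 0) :
    IntegrableOn (fun y => Iker p α x y * u y) {y : ℚ_[p] | ‖y‖ ≤ ‖x‖} (padicHaar p) ∧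
    (∀ x' : ℚ_[p], ‖x'‖ = ‖x‖ → Iop p α u x' = Iop p α u x) ∧
    Iop p α u x =
      (p : ℝ) ^ (-α) * ‖x‖ ^ α * u x +
        ((1 - (p : ℝ) ^ (-α)) / (1 - (p : ℝ) ^ (α - 1))) *
          ∫ y in {y : ℚ_[p] | ‖y‖ < ‖x‖}, (‖x‖ ^ (α - 1) - ‖y‖ ^ (α - 1)) * u y ∂(padicHaar p) := by
  obtain ⟨hI, hv⟩ := main_aux p α hα hα1 u hu m h1 x hx
  refine ⟨hI, fun x' hx' => ?_, hv⟩
  have hx0 : x' ≠ 0 := by rw [← norm_ne_zero_iff, hx']; exact norm_ne_zero_iff.2 hx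
  rw [hv, (main_aux p α hα hα1 u hu m h1 x' hx0).2, hx', hu x' x hx']
end

section
/- Let u be a radial function such that Σ_{k=−∞}^{m} |k| p^k |u(p^k)| < ∞ for some m ∈ ℤ. Then for every x ≠ 0 the integral defining (I^1 u)(x) converges absolutely, (I^1 u)(x) depends only on |x|_p, and (I^1 u)(|x|_p) = p^{−1} |x|_p u(|x|_p) + ((1 − p)/(p log p)) ∫_{|y|_p < |x|_p} (log|x|_p − log|y|_p) u(|y|_p) dy. -/
open MeasureTheory Metric

lemma padic_p_pos (p : ℕ) [hp : Fact p.Prime] : (0 : ℝ) < p := by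
  exact_mod_cast hp.out.pos

lemma padic_one_lt (p : ℕ) [hp : Fact p.Prime] : (1 : ℝ) < p := by
  exact_mod_cast hp.out.one_lt

/-- The closed ball of radius `p^k`. -/
def padicB (p : ℕ) [Fact p.Prime] (k : ℤ) : Set ℚ_[p] := closedBall 0 ((p : ℝ) ^ k)

lemma mem_padicB (p : ℕ) [Fact p.Prime] (k : ℤ) (y : ℚ_[p]) :
    y ∈ padicB p k ↔ ‖y‖ ≤ (p : ℝ) ^ k := by
  simp [padicB]

lemma padicB_meas (p : ℕ) [Fact p.Prime] (k : ℤ) : MeasurableSet (padicB p k) :=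
  isClosed_closedBall.measurableSet

lemma padicB_ne_top (p : ℕ) [Fact p.Prime] (k : ℤ) : padicHaar p (padicB p k) ≠ ⊤ :=
  (isCompact_closedBall (0 : ℚ_[p]) ((p : ℝ) ^ k)).measure_lt_top.ne

lemma padicB_succ (p : ℕ) [hp : Fact p.Prime] (k : ℤ) :
    padicB p (k + 1) = ⋃ i : Fin p,
      (fun y => -((i : ℕ) * (p : ℚ_[p]) ^ (-(k + 1))) + y) ⁻¹' padicB p k := by
  have hp0 := padic_p_pos p
  have hpk : (p : ℚ_[p]) ≠ 0 := by exact_mod_cast hp.out.ne_zero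
  ext y
  simp only [Set.mem_iUnion, Set.mem_preimage, mem_padicB]
  constructor
  · intro hy
    have hz : ‖y * (p : ℚ_[p]) ^ (k + 1)‖ ≤ 1 := by
      rw [norm_mul, Padic.norm_p_zpow, zpow_neg]
      have := zpow_pos hp0 (k + 1)
      rw [← div_eq_mul_inv, div_le_one this]; exact hy
    set z : ℤ_[p] := ⟨_, hz⟩ with hzdef
    refine ⟨⟨z.zmodRepr, z.zmodRepr_lt_p⟩, ?_⟩
    have h := z.norm_sub_zmodRepr_lt_one
    rw [PadicInt.norm_def] at h
    push_cast at h
    have hzc : (z : ℚ_[p]) = y * (p : ℚ_[p]) ^ (k + 1) := rfl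
    rw [Padic.norm_le_pow_iff_norm_lt_pow_add_one]
    have e : -((z.zmodRepr : ℚ_[p]) * (p : ℚ_[p]) ^ (-(k + 1))) + y
        = ((z : ℚ_[p]) - z.zmodRepr) * (p : ℚ_[p]) ^ (-(k + 1)) := by
      rw [hzc, sub_mul, mul_assoc, ← zpow_add₀ hpk]; simp; ring
    simp only [e, norm_mul, Padic.norm_p_zpow, neg_neg]
    have := zpow_pos hp0 (k + 1)
    nlinarith
  · rintro ⟨i, hi⟩
    have e : y = (i : ℕ) * (p : ℚ_[p]) ^ (-(k + 1)) +
      (-((i : ℕ) * (p : ℚ_[p]) ^ (-(k + 1))) + y) := by ring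
    rw [e]
    refine (Padic.nonarchimedean _ _).trans (max_le ?_ (hi.trans ?_))
    · rw [norm_mul, Padic.norm_p_zpow, neg_neg]
      have h1 : ‖((i : ℕ) : ℚ_[p])‖ ≤ 1 := by
        exact_mod_cast Padic.norm_int_le_one (p := p) (i : ℕ)
      have := zpow_pos hp0 (k + 1)
      nlinarith
    · exact zpow_le_zpow_right₀ (padic_one_lt p).le (by omega)

lemma padicB_succ_disj (p : ℕ) [hp : Fact p.Prime] (k : ℤ) :
    Pairwise (Function.onFun Disjoint fun i : Fin p =>
      (fun y => -((i : ℕ) * (p : ℚ_[p]) ^ (-(k + 1))) + y) ⁻¹' padicB p k) := by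
  have hp0 := padic_p_pos p
  intro i j hij
  rw [Function.onFun, Set.disjoint_left]
  intro y hi hj
  simp only [Set.mem_preimage, mem_padicB] at hi hj
  apply hij
  have e : (((i : ℕ) : ℤ) - ((j : ℕ) : ℤ) : ℤ) * (p : ℚ_[p]) ^ (-(k + 1)) =
    (-((j : ℕ) * (p : ℚ_[p]) ^ (-(k + 1))) + y) + -(-((i : ℕ) * (p : ℚ_[p]) ^ (-(k + 1))) + y) := by
    push_cast; ring
  have h := (Padic.nonarchimedean _ _).trans (max_le hj ((norm_neg _).le.trans hi))
  rw [← e, Padic.norm_le_pow_iff_norm_lt_pow_add_one, norm_mul, Padic.norm_p_zpow, neg_neg] at h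
  have hpos := zpow_pos hp0 (k + 1)
  have h2 : ‖((((i : ℕ) : ℤ) - ((j : ℕ) : ℤ) : ℤ) : ℚ_[p])‖ < 1 := by
    by_contra! hc
    nlinarith
  rw [Padic.norm_intCast_lt_one_iff] at h2
  have := Int.eq_zero_of_abs_lt_dvd h2 (by rw [abs_lt]; have := i.2; have := j.2; omega)
  ext; omega

lemma padicB_real_succ (p : ℕ) [hp : Fact p.Prime] (k : ℤ) :
    (padicHaar p).real (padicB p (k + 1)) = p * (padicHaar p).real (padicB p k) := by
  rw [padicB_succ, measureReal_iUnion_fintype (padicB_succ_disj p k)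
    (fun i => (measurable_const_add _) (padicB_meas p k))
    (fun i => by rw [measure_preimage_add]; exact padicB_ne_top p k)]
  simp [Measure.real, measure_preimage_add]

lemma padicB_real (p : ℕ) [hp : Fact p.Prime] (k : ℤ) :
    (padicHaar p).real (padicB p k) = (p : ℝ) ^ k := by
  have hp0 := padic_p_pos p
  induction k using Int.induction_on with
  | zero =>
    have : padicB p 0 = (unitBallPC p : Set ℚ_[p]) := by
      simp only [padicB, zpow_zero]; rfl
    rw [this, Measure.real, padicHaar, Measure.addHaarMeasure_self]; simp
  | succ k ih => rw [padicB_real_succ, ih, zpow_add_one₀ hp0.ne']; ring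
  | pred k ih =>
    have := padicB_real_succ p (-k - 1)
    rw [sub_add_cancel, ih] at this
    rw [zpow_sub_one₀ hp0.ne', this]; field_simp

/-- The sphere of radius `p^k`. -/
def padicS (p : ℕ) [Fact p.Prime] (k : ℤ) : Set ℚ_[p] := padicB p k \ padicB p (k - 1)

lemma mem_padicS (p : ℕ) [Fact p.Prime] (k : ℤ) (y : ℚ_[p]) :
    y ∈ padicS p k ↔ ‖y‖ = (p : ℝ) ^ k := by
  rw [padicS, Set.mem_sdiff, mem_padicB, mem_padicB, ← Padic.norm_lt_pow_iff_norm_le_pow_sub_one,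
    not_lt]
  exact ⟨fun h => le_antisymm h.1 h.2, fun h => ⟨h.le, h.ge⟩⟩

lemma padicS_meas (p : ℕ) [Fact p.Prime] (k : ℤ) : MeasurableSet (padicS p k) :=
  (padicB_meas p k).diff (padicB_meas p _)

lemma padicS_real (p : ℕ) [hp : Fact p.Prime] (k : ℤ) :
    (padicHaar p).real (padicS p k) = (p : ℝ) ^ k * (1 - (p : ℝ)⁻¹) := by
  have hp0 := padic_p_pos p
  have hsub : padicB p (k - 1) ⊆ padicB p k := closedBall_subset_closedBall
    (zpow_le_zpow_right₀ (padic_one_lt p).le (by omega))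
  rw [padicS, measureReal_sdiff hsub (padicB_meas p _) (padicB_ne_top p _), padicB_real,
    padicB_real, zpow_sub_one₀ hp0.ne']
  ring

lemma sph_norm (p : ℕ) [hp : Fact p.Prime] (k : ℤ) : ‖sph p k‖ = (p : ℝ) ^ k := by
  simp [sph]

lemma padicB_eq (p : ℕ) [hp : Fact p.Prime] (n : ℤ) :
    padicB p n =ᵐ[padicHaar p] ⋃ j : ℕ, padicS p (n - j) := by
  have : padicB p n \ {0} = ⋃ j : ℕ, padicS p (n - j) := by
    ext y
    simp only [Set.mem_sdiff, Set.mem_iUnion, mem_padicS, mem_padicB, Set.mem_singleton_iff]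
    constructor
    · rintro ⟨h, h0⟩
      rw [Padic.norm_eq_zpow_neg_valuation h0] at h ⊢
      have := (zpow_le_zpow_iff_right₀ (padic_one_lt p)).1 h
      exact ⟨(n + y.valuation).toNat, by congr 1; omega⟩
    · rintro ⟨j, hj⟩
      refine ⟨hj ▸ zpow_le_zpow_right₀ (padic_one_lt p).le (by omega), ?_⟩
      rintro rfl
      have := zpow_pos (padic_p_pos p) (n - j)
      simp at hj; simp [← hj] at this
  rw [← this]
  exact (sdiff_null_ae_eq_self (measure_singleton _)).symm

lemma radial_integral (p : ℕ) [hp : Fact p.Prime] (f : ℚ_[p] → ℝ) (hf : Radial p f) (n : ℤ)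
    (hs : Summable fun j : ℕ => (p : ℝ) ^ (n - j : ℤ) * |f (sph p (n - j))|) :
    IntegrableOn f (padicB p n) (padicHaar p) ∧
    ∫ y in padicB p n, f y ∂(padicHaar p) =
      ∑' j : ℕ, (p : ℝ) ^ (n - j : ℤ) * (1 - (p : ℝ)⁻¹) * f (sph p (n - j)) := by
  have hfin : ∀ k, padicHaar p (padicS p k) ≠ ⊤ := fun k =>
    measure_ne_top_of_subset Set.sdiff_subset (padicB_ne_top p k)
  have hc : ∀ k, Set.EqOn f (fun _ => f (sph p k)) (padicS p k) := fun k y hy =>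
    hf _ _ (by rw [(mem_padicS p k y).1 hy, sph_norm])
  have hint : ∀ k, IntegrableOn f (padicS p k) (padicHaar p) := fun k =>
    (integrableOn_congr_fun (hc k) (padicS_meas p k)).2 (integrableOn_const (hfin k))
  have hdisj : Pairwise (Function.onFun Disjoint fun j : ℕ => padicS p (n - j)) := by
    intro i j hij
    rw [Function.onFun, Set.disjoint_left]
    intro y hi hj
    rw [mem_padicS] at hi hj
    rw [hi] at hj
    have := zpow_right_injective₀ (padic_p_pos p) (padic_one_lt p).ne' hj
    simp at this; omega
  have hI : IntegrableOn f (⋃ j : ℕ, padicS p (n - j)) (padicHaar p) := by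
    refine integrableOn_iUnion_of_summable_integral_norm (fun j => hint _) ?_
    refine (hs.mul_left (1 - (p : ℝ)⁻¹)).congr fun j => ?_
    rw [setIntegral_congr_fun (padicS_meas p _) (g := fun _ => ‖f (sph p (n - j))‖)
      (fun y hy => by simp only [hc _ hy])]
    rw [setIntegral_const, padicS_real, Real.norm_eq_abs, smul_eq_mul]; ring
  refine ⟨hI.congr_set_ae (padicB_eq p n), ?_⟩
  rw [setIntegral_congr_set (padicB_eq p n), integral_iUnion (fun j => padicS_meas p _) hdisj hI]
  congr 1; ext j
  rw [setIntegral_congr_fun (padicS_meas p _) (hc _), setIntegral_const, padicS_real, smul_eq_mul]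

lemma log_part (p : ℕ) [hp : Fact p.Prime] (n : ℤ) :
    IntegrableOn (fun y : ℚ_[p] => Real.log ‖y‖ - n * Real.log p) (padicB p n) (padicHaar p) ∧
    ∫ y in padicB p n, (Real.log ‖y‖ - n * Real.log p) ∂(padicHaar p) =
      - ((p : ℝ) ^ n * Real.log p / (p - 1)) := by
  have hp0 := padic_p_pos p
  have hp1 := padic_one_lt p
  have hL := Real.log_pos hp1
  have hg : HasSum (fun j : ℕ => (j : ℝ) * ((p : ℝ)⁻¹) ^ j) ((p : ℝ)⁻¹ / (1 - (p : ℝ)⁻¹) ^ 2) :=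
    hasSum_coe_mul_geometric_of_norm_lt_one (by
      rw [norm_inv, Real.norm_of_nonneg hp0.le]; exact inv_lt_one_of_one_lt₀ hp1)
  have hv : ∀ j : ℕ, Real.log ‖sph p (n - j)‖ - n * Real.log p = - (j * Real.log p) := fun j => by
    rw [sph_norm, Real.log_zpow]; push_cast; ring
  have hz : ∀ j : ℕ, (p : ℝ) ^ (n - j : ℤ) = (p : ℝ) ^ n * (p : ℝ)⁻¹ ^ j := fun j => by
    rw [zpow_sub₀ hp0.ne', zpow_natCast, inv_pow, div_eq_mul_inv]
  have := radial_integral p (fun y => Real.log ‖y‖ - n * Real.log p)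
    (fun a b h => by simp only [h]) n ?_
  · refine ⟨this.1, this.2.trans ?_⟩
    simp only [hv, hz]
    have h2 := (hg.mul_left (-((p : ℝ) ^ n * (1 - (p : ℝ)⁻¹) * Real.log p))).tsum_eq
    have hne : (p : ℝ) - 1 ≠ 0 := by linarith
    have e : -((p : ℝ) ^ n * (1 - (p : ℝ)⁻¹) * Real.log p) * ((p : ℝ)⁻¹ / (1 - (p : ℝ)⁻¹) ^ 2)
        = - ((p : ℝ) ^ n * Real.log p / (p - 1)) := by
      have : 1 - (p : ℝ)⁻¹ = (p - 1) / p := by field_simp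
      rw [this]; field_simp
    rw [← e, ← h2]
    congr 1; ext j; ring
  · refine (hg.summable.mul_left ((p : ℝ) ^ n * Real.log p)).congr fun j => ?_
    simp only [hv, hz, abs_neg]
    rw [abs_of_nonneg (by positivity)]; ring

lemma u_part (p : ℕ) [hp : Fact p.Prime] (u : ℚ_[p] → ℝ) (hu : Radial p u) (m : ℤ)
    (h1 : Summable fun j : ℕ => |((m - j : ℤ) : ℝ)| * (p : ℝ) ^ (m - j : ℤ) * |u (sph p (m - j))|)
    (n : ℤ) :
    IntegrableOn (fun y : ℚ_[p] => (n * Real.log p - Real.log ‖y‖) * u y) (padicB p n)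
      (padicHaar p) := by
  have hp0 := padic_p_pos p
  have hL := Real.log_pos (padic_one_lt p)
  refine (radial_integral p _ (fun a b h => by simp only [h, hu a b h]) n ?_).1
  set K : ℤ := -(|n| + |m| + 1) with hK
  have ha : n - ((n - K).toNat : ℤ) = K := by
    have := neg_abs_le n; have := abs_nonneg m; omega
  have hb : m - ((m - K).toNat : ℤ) = K := by
    have := neg_abs_le m; have := abs_nonneg n; omega
  rw [← summable_nat_add_iff (n - K).toNat]
  rw [← summable_nat_add_iff (m - K).toNat] at h1
  have ha' : ∀ j : ℕ, n - ((j + (n - K).toNat : ℕ) : ℤ) = K - j := fun j => by push_cast; omega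
  have hb' : ∀ j : ℕ, m - ((j + (m - K).toNat : ℕ) : ℤ) = K - j := fun j => by push_cast; omega
  simp only [ha']
  simp only [hb'] at h1
  refine Summable.of_nonneg_of_le (fun j => by positivity) (fun j => ?_)
    (h1.mul_left (2 * Real.log p))
  have hbd : |(n : ℝ) - ((K - j : ℤ) : ℝ)| ≤ 2 * |((K - j : ℤ) : ℝ)| := by
    have : |n - (K - j)| ≤ 2 * |K - j| := by
      have := neg_abs_le n; have := abs_nonneg m; have := le_abs_self n
      rw [abs_of_nonneg (a := n - (K - j)) (by omega), abs_of_nonpos (a := K - j) (by omega)]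
      omega
    exact_mod_cast this
  rw [sph_norm, Real.log_zpow, abs_mul, ← sub_mul, abs_mul, abs_of_pos hL]
  have hn : 0 ≤ (p : ℝ) ^ (K - j : ℤ) * Real.log p * |u (sph p (K - j))| := by positivity
  nlinarith [mul_le_mul_of_nonneg_right hbd hn]

/-- The key splitting and the resulting formula. -/
lemma main_formula (p : ℕ) [hp : Fact p.Prime]
    (u : ℚ_[p] → ℝ) (hu : Radial p u) (m : ℤ)
    (h1 : Summable fun j : ℕ => |((m - j : ℤ) : ℝ)| * (p : ℝ) ^ (m - j : ℤ) * |u (sph p (m - j))|)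
    (x : ℚ_[p]) (hx : x ≠ 0) :
    IntegrableOn (fun y => Iker p 1 x y * u y) {y : ℚ_[p] | ‖y‖ ≤ ‖x‖} (padicHaar p) ∧
    Iop p 1 u x =
      (p : ℝ)⁻¹ * ‖x‖ * u x +
        ((1 - (p : ℝ)) / ((p : ℝ) * Real.log p)) *
          ∫ y in {y : ℚ_[p] | ‖y‖ < ‖x‖},
            (Real.log ‖x‖ - Real.log ‖y‖) * u y ∂(padicHaar p) := by
  have hp0 := padic_p_pos p
  have hp1 := padic_one_lt p
  have hL := Real.log_pos hp1
  obtain ⟨n, hn⟩ : ∃ n : ℤ, ‖x‖ = (p : ℝ) ^ n := ⟨_, Padic.norm_eq_zpow_neg_valuation hx⟩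
  have hlog : Real.log ‖x‖ = n * Real.log p := by rw [hn, Real.log_zpow]
  have hB : {y : ℚ_[p] | ‖y‖ ≤ ‖x‖} = padicB p n := by ext y; simp [mem_padicB, hn]
  obtain ⟨hg, hgi⟩ := log_part p n
  have hw := u_part p u hu m h1 n
  rw [hB, hlog]
  set μ := padicHaar p
  set g : ℚ_[p] → ℝ := fun y => Real.log ‖y‖ - n * Real.log p with hgdef
  set w : ℚ_[p] → ℝ := fun y => (n * Real.log p - Real.log ‖y‖) * u y with hwdef
  set U : Set ℚ_[p] := {y : ℚ_[p] | ‖y‖ < ‖x‖} with hU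
  have hUm : MeasurableSet U := (isOpen_lt continuous_norm continuous_const).measurableSet
  have hUB : U ⊆ padicB p n := fun y hy => by rw [← hB]; exact le_of_lt (show ‖y‖ < ‖x‖ from hy)
  have hsub : ∀ y, x - y ∈ padicB p n ↔ y ∈ padicB p n := by
    have key : ∀ y, y ∈ padicB p n → x - y ∈ padicB p n := fun y hy => by
      rw [mem_padicB] at hy ⊢
      rw [sub_eq_add_neg]
      exact (Padic.nonarchimedean _ _).trans (max_le hn.le ((norm_neg y).le.trans hy))
    exact fun y => ⟨fun h => by simpa using key _ h, key y⟩
  have hind : (fun y => (padicB p n).indicator g (x - y)) =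
      (padicB p n).indicator (fun y => g (x - y)) := by
    ext y
    by_cases hy : y ∈ padicB p n
    · rw [Set.indicator_of_mem hy, Set.indicator_of_mem ((hsub y).2 hy)]
    · rw [Set.indicator_of_notMem hy, Set.indicator_of_notMem (fun h => hy ((hsub y).1 h))]
  have hgx : IntegrableOn (fun y => g (x - y)) (padicB p n) μ := by
    rw [← integrable_indicator_iff (padicB_meas p n), ← hind]
    exact ((integrable_indicator_iff (padicB_meas p n)).2 hg).comp_sub_left x
  have hgxi : ∫ y in padicB p n, g (x - y) ∂μ = ∫ y in padicB p n, g y ∂μ := by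
    rw [← integral_indicator (padicB_meas p n), ← hind,
      integral_sub_left_eq_self ((padicB p n).indicator g) μ x, integral_indicator (padicB_meas p n)]
  have hwU : IntegrableOn (U.indicator w) (padicB p n) μ := hw.indicator hUm
  have hsplit : Set.EqOn (fun y => Iker p 1 x y * u y)
      (fun y => g (x - y) * u x + U.indicator w y) (padicB p n) := by
    intro y hy
    rw [← hB] at hy
    simp only [Iker, if_true, hgdef]
    by_cases hyU : y ∈ U
    · have e : ‖x - y‖ = ‖x‖ := by
        have hne : ‖x‖ ≠ ‖-y‖ := by rw [norm_neg]; exact (ne_of_lt (show ‖y‖ < ‖x‖ from hyU)).symm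
        rw [sub_eq_add_neg, Padic.add_eq_max_of_ne hne, norm_neg]
        exact max_eq_left (le_of_lt (show ‖y‖ < ‖x‖ from hyU))
      rw [Set.indicator_of_mem hyU, e, hlog]; simp [hwdef]
    · have e : ‖y‖ = ‖x‖ := le_antisymm hy (not_lt.1 hyU)
      rw [Set.indicator_of_notMem hyU, e, hlog, hu y x e]; simp
  have hA := hgx.mul_const (u x)
  refine ⟨(integrableOn_congr_fun hsplit (padicB_meas p n)).2 (hA.add hwU), ?_⟩
  rw [Iop, hB, setIntegral_congr_fun (padicB_meas p n) hsplit, integral_add hA hwU,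
    integral_mul_const, hgxi, hgi, setIntegral_indicator hUm, Set.inter_eq_self_of_subset_right hUB,
    mul_add]
  simp only [Icoef, if_true]
  congr 1
  rw [hn]
  have hne : (p : ℝ) - 1 ≠ 0 := by linarith
  field_simp
  ring

/-- the fractional integral of a radial function, `α = 1`. -/
theorem fractional_integral_radial_one (p : ℕ) [Fact p.Prime]
    (u : ℚ_[p] → ℝ) (hu : Radial p u) (m : ℤ)
    (h1 : Summable fun j : ℕ => |((m - j : ℤ) : ℝ)| * (p : ℝ) ^ (m - j : ℤ) * |u (sph p (m - j))|)
    (x : ℚ_[p]) (hx : x ≠ 0) :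
    IntegrableOn (fun y => Iker p 1 x y * u y) {y : ℚ_[p] | ‖y‖ ≤ ‖x‖} (padicHaar p) ∧
    (∀ x' : ℚ_[p], ‖x'‖ = ‖x‖ → Iop p 1 u x' = Iop p 1 u x) ∧
    Iop p 1 u x =
      (p : ℝ)⁻¹ * ‖x‖ * u x +
        ((1 - (p : ℝ)) / ((p : ℝ) * Real.log p)) *
          ∫ y in {y : ℚ_[p] | ‖y‖ < ‖x‖},
            (Real.log ‖x‖ - Real.log ‖y‖) * u y ∂(padicHaar p) := by
  refine ⟨(main_formula p u hu m h1 x hx).1, fun x' hx' => ?_, (main_formula p u hu m h1 x hx).2⟩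
  have hx0 : x' ≠ 0 := by
    rw [← norm_ne_zero_iff, hx', norm_ne_zero_iff]; exact hx
  rw [(main_formula p u hu m h1 x' hx0).2, (main_formula p u hu m h1 x hx).2, hx', hu x' x hx']
end

section
/- Let α > 0 and ε > 0. Then there exists a constant A > 0 such that for every real σ with σ ≥ max(−1/α, −1) + ε and every t ∈ ℚ_p, t ≠ 0: if α ≠ 1 then ∫_{|y|_p < |t|_p} | |t|_p^{α−1} − |y|_p^{α−1} | · |y|_p^{ασ} dy ≤ A p^{−ασ} |t|_p^{α(σ+1)}, and if α = 1 then ∫_{|y|_p < |t|_p} (log|t|_p − log|y|_p) |y|_p^{σ} dy ≤ A p^{−σ} |t|_p^{σ+1}. -/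
open MeasureTheory Metric

lemma haar_ball_succ (p : ℕ) [Fact p.Prime] (n : ℤ) :
    padicHaar p (closedBall 0 ((p : ℝ) ^ (n + 1))) =
      p * padicHaar p (closedBall 0 ((p : ℝ) ^ n)) := by
  have hp : (p : ℝ) ≠ 0 := by exact_mod_cast (Fact.out : p.Prime).ne_zero
  have hpp : (0 : ℝ) < p := by exact_mod_cast (Fact.out : p.Prime).pos
  have hpQ : (p : ℚ_[p]) ≠ 0 := by exact_mod_cast (Fact.out : p.Prime).ne_zero
  have : (padicHaar p).IsAddHaarMeasure := by unfold padicHaar; infer_instance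
  set w : ℚ_[p] := (p : ℚ_[p]) ^ (-(n + 1)) with hw
  have hwn : ‖w‖ = (p : ℝ) ^ (n + 1) := by
    rw [hw, Padic.norm_p_zpow, neg_neg]
  have hw0 : w ≠ 0 := zpow_ne_zero _ hpQ
  have key : closedBall (0 : ℚ_[p]) ((p : ℝ) ^ (n + 1)) =
      ⋃ i ∈ Finset.range p, closedBall ((i : ℚ_[p]) * w) ((p : ℝ) ^ n) := by
    ext x
    simp only [Set.mem_iUnion, mem_closedBall, dist_eq_norm, sub_zero, Finset.mem_range,
      exists_prop]
    constructor
    · intro hx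
      have hx1 : ‖x / w‖ ≤ 1 := by
        rw [norm_div, hwn]
        exact div_le_one_of_le₀ hx (by positivity)
      obtain ⟨i, hi, hi2⟩ := PadicInt.exists_mem_range (p := p) ⟨x / w, hx1⟩
      refine ⟨i, hi, ?_⟩
      rw [PadicInt.maximalIdeal_eq_span_p, Ideal.mem_span_singleton,
        ← PadicInt.norm_lt_one_iff_dvd, PadicInt.norm_def] at hi2
      push_cast at hi2
      rw [Padic.norm_le_pow_iff_norm_lt_pow_add_one]
      have : x - i * w = (x / w - i) * w := by field_simp
      rw [this, norm_mul, hwn]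
      have h3 : (0 : ℝ) < (p : ℝ) ^ (n + 1) := by positivity
      calc _ < 1 * (p : ℝ) ^ (n + 1) := mul_lt_mul_of_pos_right hi2 h3
        _ = _ := one_mul _
    · rintro ⟨i, hi, h⟩
      have h1 : x = (x - i * w) + i * w := by ring
      rw [h1]
      refine (Padic.nonarchimedean _ _).trans (max_le (h.trans ?_) ?_)
      · exact zpow_le_zpow_right₀ (by exact_mod_cast (Fact.out : p.Prime).one_le) (by omega)
      · rw [norm_mul, hwn]
        have h2 : ‖(i : ℚ_[p])‖ ≤ 1 := by
          simpa using Padic.norm_int_le_one (p := p) (i : ℤ)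
        exact mul_le_of_le_one_left (by positivity) h2
  have hdisj : Set.PairwiseDisjoint (↑(Finset.range p))
      (fun i : ℕ => closedBall ((i : ℚ_[p]) * w) ((p : ℝ) ^ n)) := by
    intro i hi j hj hij
    rw [Function.onFun, Set.disjoint_left]
    intro x hx hx'
    simp only [mem_closedBall, dist_eq_norm] at hx hx'
    have h1 : ‖((i : ℚ_[p]) - j) * w‖ ≤ (p : ℝ) ^ n := by
      have : ((i : ℚ_[p]) - j) * w = (x - j * w) + -(x - i * w) := by ring
      rw [this]
      refine (Padic.nonarchimedean _ _).trans (max_le hx' ?_)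
      rwa [norm_neg]
    rw [Padic.norm_le_pow_iff_norm_lt_pow_add_one, norm_mul, hwn] at h1
    have h2 : ‖(((i : ℤ) - (j : ℤ) : ℤ) : ℚ_[p])‖ < 1 := by
      push_cast
      have h3 : (0 : ℝ) < (p : ℝ) ^ (n + 1) := by positivity
      exact lt_of_mul_lt_mul_right (by linarith) h3.le
    rw [Padic.norm_intCast_lt_one_iff] at h2
    simp only [Finset.coe_range, Set.mem_Iio] at hi hj
    have h4 := Int.eq_zero_of_abs_lt_dvd h2 (by rw [abs_lt]; omega)
    omega
  rw [key, measure_biUnion_finset hdisj (fun i _ => isClosed_closedBall.measurableSet)]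
  have : ∀ i ∈ Finset.range p, padicHaar p (closedBall ((i : ℚ_[p]) * w) ((p : ℝ) ^ n)) =
      padicHaar p (closedBall 0 ((p : ℝ) ^ n)) := by
    intro i _
    rw [← measure_preimage_add_right (padicHaar p) (-((i : ℚ_[p]) * w)) (closedBall 0 ((p : ℝ) ^ n))]
    congr 1
    ext x
    simp [dist_eq_norm, sub_eq_add_neg]
  rw [Finset.sum_congr rfl this]
  simp

lemma haar_ball (p : ℕ) [Fact p.Prime] (n : ℤ) :
    padicHaar p (closedBall 0 ((p : ℝ) ^ n)) = ENNReal.ofReal ((p : ℝ) ^ n) := by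
  have hpp : (0 : ℝ) < p := by exact_mod_cast (Fact.out : p.Prime).pos
  have hpn : (p : ENNReal) ≠ 0 := by exact_mod_cast (Fact.out : p.Prime).ne_zero
  have step : ∀ m : ℤ, ENNReal.ofReal ((p : ℝ) ^ (m + 1)) = p * ENNReal.ofReal ((p : ℝ) ^ m) := by
    intro m
    rw [zpow_add_one₀ hpp.ne', mul_comm, ENNReal.ofReal_mul hpp.le, ENNReal.ofReal_natCast]
  induction n using Int.induction_on with
  | zero =>
    simp only [zpow_zero, ENNReal.ofReal_one]
    exact Measure.addHaarMeasure_self (K₀ := unitBallPC p)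
  | succ k ih => rw [haar_ball_succ, ih, step]
  | pred k ih =>
    have h1 := haar_ball_succ p (-(k : ℤ) - 1)
    have h2 := step (-(k : ℤ) - 1)
    rw [sub_add_cancel] at h1 h2
    rw [ih, h2] at h1
    exact ((ENNReal.mul_right_inj hpn (ENNReal.natCast_ne_top p)).1 h1).symm

lemma integral_sphere_bound (p : ℕ) [Fact p.Prime] (f : ℚ_[p] → ℝ) (t : ℚ_[p]) (ht : t ≠ 0)
    (a : ℕ → ℝ) (ha : Summable a) (ha0 : ∀ j, 0 ≤ a j) (K : ℝ) (hK : 0 ≤ K)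
    (h : ∀ (j : ℕ) (y : ℚ_[p]), ‖y‖ = ‖t‖ * ((p : ℝ) ^ (j + 1))⁻¹ → |f y| * ‖y‖ ≤ K * a j) :
    (∫ y in {y : ℚ_[p] | ‖y‖ < ‖t‖}, f y ∂(padicHaar p)) ≤ K * ∑' j, a j := by
  have hpp : (0 : ℝ) < p := by exact_mod_cast (Fact.out : p.Prime).pos
  have : (padicHaar p).IsAddHaarMeasure := by unfold padicHaar; infer_instance
  have htn : 0 < ‖t‖ := norm_pos_iff.2 ht
  have hm := Padic.norm_eq_zpow_neg_valuation ht
  set m := -t.valuation with hmdef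
  let s : ℕ → Set ℚ_[p] := fun j => {y | ‖y‖ = ‖t‖ * ((p : ℝ) ^ (j + 1))⁻¹}
  have hsm : ∀ j, MeasurableSet (s j) := fun j =>
    (isClosed_eq continuous_norm continuous_const).measurableSet
  have hrad : ∀ j : ℕ, ‖t‖ * ((p : ℝ) ^ (j + 1))⁻¹ = (p : ℝ) ^ (m - (j + 1 : ℕ)) := by
    intro j
    rw [hm, zpow_sub₀ hpp.ne', zpow_natCast, div_eq_mul_inv]
  have hsub : {y : ℚ_[p] | ‖y‖ < ‖t‖} ⊆ {0} ∪ ⋃ j, s j := by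
    intro y hy
    by_cases hy0 : y = 0
    · left; exact hy0
    right
    simp only [Set.mem_ofPred_eq] at hy
    have hk := Padic.norm_eq_zpow_neg_valuation hy0
    rw [hk, hm, zpow_lt_zpow_iff_right₀ (by exact_mod_cast (Fact.out : p.Prime).one_lt)] at hy
    rw [Set.mem_iUnion]
    refine ⟨(m - (-y.valuation) - 1).toNat, ?_⟩
    change ‖y‖ = _
    rw [hrad, hk]
    congr 1
    omega
  have hs : ∀ j, ∫⁻ y in s j, ENNReal.ofReal ‖f y‖ ∂(padicHaar p) ≤ ENNReal.ofReal (K * a j) := by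
    intro j
    set r := ‖t‖ * ((p : ℝ) ^ (j + 1))⁻¹ with hr
    have hr0 : 0 < r := by positivity
    have hmu : padicHaar p (s j) ≤ ENNReal.ofReal r := by
      rw [hr, hrad, ← haar_ball]
      refine measure_mono ?_
      intro y hy
      rw [mem_closedBall, dist_zero_right, ← hrad]
      exact le_of_eq hy
    calc _ ≤ ∫⁻ y in s j, ENNReal.ofReal (K * a j / r) ∂(padicHaar p) := by
          refine setLIntegral_mono' (hsm j) ?_
          intro y hy
          refine ENNReal.ofReal_le_ofReal ?_
          have := h j y hy
          rw [le_div_iff₀ hr0]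
          have hy' : ‖y‖ = r := hy
          rwa [hy'] at this
      _ = ENNReal.ofReal (K * a j / r) * padicHaar p (s j) := by
          rw [setLIntegral_const]
      _ ≤ ENNReal.ofReal (K * a j / r) * ENNReal.ofReal r := by gcongr
      _ = ENNReal.ofReal (K * a j) := by
          rw [← ENNReal.ofReal_mul (div_nonneg (mul_nonneg hK (ha0 j)) hr0.le),
            div_mul_cancel₀ _ hr0.ne']
  have hl : ∫⁻ y in {y : ℚ_[p] | ‖y‖ < ‖t‖}, ENNReal.ofReal ‖f y‖ ∂(padicHaar p)
      ≤ ENNReal.ofReal (K * ∑' j, a j) := by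
    calc _ ≤ ∫⁻ y in {0} ∪ ⋃ j, s j, ENNReal.ofReal ‖f y‖ ∂(padicHaar p) :=
          lintegral_mono_set hsub
      _ ≤ ∫⁻ y in {0}, ENNReal.ofReal ‖f y‖ ∂(padicHaar p) +
          ∫⁻ y in ⋃ j, s j, ENNReal.ofReal ‖f y‖ ∂(padicHaar p) := lintegral_union_le _ _ _
      _ ≤ 0 + ∑' j, ENNReal.ofReal (K * a j) := by
          refine add_le_add ?_ ((lintegral_iUnion_le _ _).trans (ENNReal.tsum_le_tsum hs))
          rw [setLIntegral_measure_zero _ _ (measure_singleton _)]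
      _ = _ := by
          rw [zero_add, ← tsum_mul_left, ENNReal.ofReal_tsum_of_nonneg
            (fun j => mul_nonneg hK (ha0 j)) (ha.mul_left K)]
  refine (Real.le_norm_self _).trans ((norm_integral_le_lintegral_norm _).trans ?_)
  exact ENNReal.toReal_le_of_le_ofReal (mul_nonneg hK (tsum_nonneg ha0)) hl

/-- The geometric estimate. -/
lemma rho_bound (p : ℕ) [Fact p.Prime] (e s g : ℝ) (hg : 0 ≤ g) (h : e ≤ s + g) (j : ℕ) :
    (((p : ℝ) ^ (j + 1))⁻¹) ^ (s + g) ≤ (p : ℝ) ^ (-s) * ((p : ℝ) ^ (-e)) ^ j := by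
  have hp1 : (1 : ℝ) ≤ p := by exact_mod_cast (Fact.out : p.Prime).one_le
  have hpp : (0 : ℝ) < p := by linarith
  rw [← Real.rpow_natCast, ← Real.rpow_neg hpp.le, ← Real.rpow_mul hpp.le,
    ← Real.rpow_natCast, ← Real.rpow_mul hpp.le, ← Real.rpow_add hpp]
  refine Real.rpow_le_rpow_of_exponent_le hp1 ?_
  push_cast
  have : (j : ℝ) * e ≤ j * (s + g) := mul_le_mul_of_nonneg_left h (Nat.cast_nonneg _)
  linarith

/-- uniform bound on the integrals `I_{α,σ}` for `σ` bounded away from the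
critical exponent. -/
theorem I_alpha_sigma_uniform_bound (p : ℕ) [Fact p.Prime] (α ε : ℝ) (hα : 0 < α) (hε : 0 < ε) :
    ∃ A : ℝ, 0 < A ∧ ∀ σ : ℝ, max (-1 / α) (-1) + ε ≤ σ → ∀ t : ℚ_[p], t ≠ 0 →
      (α ≠ 1 →
        (∫ y in {y : ℚ_[p] | ‖y‖ < ‖t‖},
            |‖t‖ ^ (α - 1) - ‖y‖ ^ (α - 1)| * ‖y‖ ^ (α * σ) ∂(padicHaar p)) ≤
          A * (p : ℝ) ^ (-α * σ) * ‖t‖ ^ (α * (σ + 1))) ∧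
      (α = 1 →
        (∫ y in {y : ℚ_[p] | ‖y‖ < ‖t‖},
            (Real.log ‖t‖ - Real.log ‖y‖) * ‖y‖ ^ σ ∂(padicHaar p)) ≤
          A * (p : ℝ) ^ (-σ) * ‖t‖ ^ (σ + 1)) := by
  have hp1 : (1 : ℝ) < p := by exact_mod_cast (Fact.out : p.Prime).one_lt
  have hpp : (0 : ℝ) < p := by linarith
  have hlog : 0 < Real.log p := Real.log_pos hp1
  set q : ℝ := (p : ℝ) ^ (-(α * ε)) with hq
  have hq0 : 0 < q := Real.rpow_pos_of_pos hpp _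
  have hq1 : q < 1 := Real.rpow_lt_one_of_one_lt_of_neg hp1 (by nlinarith)
  let a : ℕ → ℝ := fun j => (1 + ((j : ℝ) + 1) * Real.log p) * q ^ j
  have ha0 : ∀ j, 0 < a j := fun j => by positivity
  have ha : Summable a := by
    have h1 : Summable (fun j : ℕ => q ^ j) := summable_geometric_of_lt_one hq0.le hq1
    have h2 : Summable (fun j : ℕ => (j : ℝ) ^ 1 * q ^ j) :=
      summable_pow_mul_geometric_of_norm_lt_one 1 (by rwa [Real.norm_of_nonneg hq0.le])
    refine ((h1.mul_left (1 + Real.log p)).add (h2.mul_left (Real.log p))).congr ?_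
    intro j
    simp only [a]
    ring
  refine ⟨∑' j, a j, ha.tsum_pos (fun j => (ha0 j).le) 0 (ha0 0), ?_⟩
  intro σ hσ t ht
  have hT : 0 < ‖t‖ := norm_pos_iff.2 ht
  have hs1 : -1 + α * ε ≤ α * σ := by
    have h1 : -1 / α + ε ≤ σ := le_trans (by gcongr; exact le_max_left _ _) hσ
    have h2 := mul_le_mul_of_nonneg_left h1 hα.le
    have h3 : α * (-1 / α + ε) = -1 + α * ε := by field_simp
    linarith
  have hs2 : -α + α * ε ≤ α * σ := by
    have h1 : -1 + ε ≤ σ := le_trans (by gcongr; exact le_max_right _ _) hσ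
    have h2 := mul_le_mul_of_nonneg_left h1 hα.le
    linarith
  constructor
  · intro _
    have hK : 0 ≤ (p : ℝ) ^ (-α * σ) * ‖t‖ ^ (α * (σ + 1)) := by positivity
    refine (integral_sphere_bound p _ t ht a ha (fun j => (ha0 j).le) _ hK ?_).trans
      (le_of_eq (by ring))
    intro j y hy
    set ρ : ℝ := ((p : ℝ) ^ (j + 1))⁻¹ with hρ
    have hρ0 : 0 < ρ := by positivity
    have hρ1 : ρ ≤ 1 := inv_le_one_of_one_le₀ (one_le_pow₀ hp1.le)
    rw [hy, abs_mul, abs_abs, abs_of_nonneg (by positivity : 0 ≤ (‖t‖ * ρ) ^ (α * σ)),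
      Real.mul_rpow hT.le hρ0.le, Real.mul_rpow hT.le hρ0.le]
    have hmain : ∀ g : ℝ, 0 ≤ g → α * ε ≤ α * σ + g → |1 - ρ ^ (α - 1)| ≤ ρ ^ (g - 1) →
        |‖t‖ ^ (α - 1) - ‖t‖ ^ (α - 1) * ρ ^ (α - 1)| * (‖t‖ ^ (α * σ) * ρ ^ (α * σ)) *
          (‖t‖ * ρ) ≤ (p : ℝ) ^ (-α * σ) * ‖t‖ ^ (α * (σ + 1)) * a j := by
      intro g hg hge hb
      have e1 : ‖t‖ ^ (α * (σ + 1)) = ‖t‖ ^ (α - 1) * ‖t‖ ^ (α * σ) * ‖t‖ := by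
        nth_rewrite 4 [← Real.rpow_one ‖t‖]
        rw [← Real.rpow_add hT, ← Real.rpow_add hT]
        congr 1; ring
      have e2 : ρ ^ (α * σ + g) = ρ ^ (g - 1) * ρ ^ (α * σ) * ρ := by
        nth_rewrite 4 [← Real.rpow_one ρ]
        rw [← Real.rpow_add hρ0, ← Real.rpow_add hρ0]
        congr 1; ring
      have e3 : |‖t‖ ^ (α - 1) - ‖t‖ ^ (α - 1) * ρ ^ (α - 1)| =
          ‖t‖ ^ (α - 1) * |1 - ρ ^ (α - 1)| := by
        have e4 : ‖t‖ ^ (α - 1) - ‖t‖ ^ (α - 1) * ρ ^ (α - 1) =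
            ‖t‖ ^ (α - 1) * (1 - ρ ^ (α - 1)) := by ring
        rw [e4, abs_mul, abs_of_nonneg (by positivity : 0 ≤ ‖t‖ ^ (α - 1))]
      have hr := rho_bound p (α * ε) (α * σ) g hg hge j
      rw [← hρ, ← hq] at hr
      have haj : q ^ j ≤ a j := by
        simp only [a]
        have : 0 ≤ ((j : ℝ) + 1) * Real.log p := by positivity
        exact le_mul_of_one_le_left (by positivity) (by linarith)
      have hn : -α * σ = -(α * σ) := by ring
      rw [e3, e1, hn]
      calc _ = ‖t‖ ^ (α - 1) * ‖t‖ ^ (α * σ) * ‖t‖ * (|1 - ρ ^ (α - 1)| * ρ ^ (α * σ) * ρ) := by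
            ring
        _ ≤ ‖t‖ ^ (α - 1) * ‖t‖ ^ (α * σ) * ‖t‖ * (ρ ^ (g - 1) * ρ ^ (α * σ) * ρ) := by gcongr
        _ ≤ ‖t‖ ^ (α - 1) * ‖t‖ ^ (α * σ) * ‖t‖ * ((p : ℝ) ^ (-(α * σ)) * q ^ j) := by
            rw [← e2]; gcongr
        _ ≤ ‖t‖ ^ (α - 1) * ‖t‖ ^ (α * σ) * ‖t‖ * ((p : ℝ) ^ (-(α * σ)) * a j) := by gcongr
        _ = _ := by ring
    rcases le_total 1 α with h | h
    · refine hmain 1 zero_le_one (by linarith) ?_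
      have h1 : ρ ^ (α - 1) ≤ 1 := Real.rpow_le_one hρ0.le hρ1 (by linarith)
      have h2 : 0 < ρ ^ (α - 1) := by positivity
      rw [sub_self, Real.rpow_zero, abs_le]
      constructor <;> linarith
    · refine hmain α hα.le (by linarith) ?_
      have h1 : 1 ≤ ρ ^ (α - 1) := Real.one_le_rpow_of_pos_of_le_one_of_nonpos hρ0 hρ1 (by linarith)
      rw [abs_le]
      constructor <;> linarith
  · intro h1
    subst h1
    have hK : 0 ≤ (p : ℝ) ^ (-σ) * ‖t‖ ^ (σ + 1) := by positivity
    refine (integral_sphere_bound p _ t ht a ha (fun j => (ha0 j).le) _ hK ?_).trans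
      (le_of_eq (by ring))
    intro j y hy
    set ρ : ℝ := ((p : ℝ) ^ (j + 1))⁻¹ with hρ
    have hρ0 : 0 < ρ := by positivity
    have hl : Real.log ‖t‖ - Real.log (‖t‖ * ρ) = ((j : ℝ) + 1) * Real.log p := by
      rw [Real.log_mul hT.ne' hρ0.ne', hρ, Real.log_inv, Real.log_pow]
      push_cast; ring
    have hr := rho_bound p (1 * ε) σ 1 zero_le_one (by linarith) j
    rw [← hρ, ← hq] at hr
    rw [hy, hl, abs_of_nonneg (by positivity), Real.mul_rpow hT.le hρ0.le]
    have haj : ((j : ℝ) + 1) * Real.log p * q ^ j ≤ a j := by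
      simp only [a]
      gcongr
      linarith
    calc _ = ‖t‖ ^ (σ + 1) * (((j : ℝ) + 1) * Real.log p * ρ ^ (σ + 1)) := by
          rw [Real.rpow_add_one hT.ne', Real.rpow_add_one hρ0.ne']; ring
      _ ≤ ‖t‖ ^ (σ + 1) * (((j : ℝ) + 1) * Real.log p * ((p : ℝ) ^ (-σ) * q ^ j)) := by gcongr
      _ = (p : ℝ) ^ (-σ) * ‖t‖ ^ (σ + 1) * (((j : ℝ) + 1) * Real.log p * q ^ j) := by ring
      _ ≤ _ := by gcongr
end
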